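/- In every associative dialgebra D over a commutative ring, the PATS satisfies the nonlinear degree-7 identity 12·I_{22111} = 0 in variables a,b (each occurring twice) and c,d,e: for all a,b,c,d,e ∈ D, 3Σ₁ − Σ₂ − Σ₃ − 2Σ₄ = 0, where σ ranges over all permutations of the five letters (a,b,c,d,e) and Σ₁ = Σ_{σ∈S₅} ε(σ)[[[a,aσ,bσ],b,cσ],dσ,eσ], Σ₂ = Σ_{σ∈S₅} ε(σ)[[a,[aσ,bσ,cσ],b],dσ,eσ], Σ₃ = Σ_{σ∈S₅} ε(σ)[[a,aσ,bσ],[cσ,dσ,eσ],b], Σ₄ = Σ_{σ∈S₅} ε(σ)[a,[[aσ,bσ,cσ],b,dσ],eσ]. The identity obtained by interchanging a and b also holds. -/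

import Mathlib

/-- An associative dialgebra over a commutative ring `k`: a `k`-module `D` with two
bilinear products `l` (left, `⊣`) and `r` (right, `⊢`) satisfying the five dialgebra axioms. -/
structure Dialgebra (k : Type*) (D : Type*) [CommRing k] [AddCommGroup D] [Module k D] where
  l : D →ₗ[k] D →ₗ[k] D
  r : D →ₗ[k] D →ₗ[k] D
  l_assoc : ∀ a b c : D, l (l a b) c = l a (l b c)
  r_assoc : ∀ a b c : D, r (r a b) c = r a (r b c)
  inner_assoc : ∀ a b c : D, l (r a b) c = r a (l b c)
  bar_right : ∀ a b c : D, r (l a b) c = r (r a b) c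
  bar_left : ∀ a b c : D, l a (l b c) = l a (r b c)

/-- The partially alternating ternary sum (PATS):
`[a,b,c] = a⊣b⊣c − a⊣c⊣b − (b⊢a)⊣c + (c⊢a)⊣b + b⊢(c⊢a) − c⊢(b⊢a)`. -/
def Dialgebra.pats {k D : Type*} [CommRing k] [AddCommGroup D] [Module k D]
    (A : Dialgebra k D) (a b c : D) : D :=
  A.l (A.l a b) c - A.l (A.l a c) b - A.l (A.r b a) c + A.l (A.r c a) b
    + A.r b (A.r c a) - A.r c (A.r b a)

/-- `12·I₂₂₁₁₁` with first fixed letter `a`, second fixed letter `b`, and `σ`-permuted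
letters `w 0,…,w 4`:
`3Σε(σ)[[[a,w(σ0),w(σ1)],b,w(σ2)],w(σ3),w(σ4)] − Σε(σ)[[a,[w(σ0),w(σ1),w(σ2)],b],w(σ3),w(σ4)]
 − Σε(σ)[[a,w(σ0),w(σ1)],[w(σ2),w(σ3),w(σ4)],b] − 2Σε(σ)[a,[[w(σ0),w(σ1),w(σ2)],b,w(σ3)],w(σ4)]`. -/
def I22111 {k D : Type*} [CommRing k] [AddCommGroup D] [Module k D]
    (A : Dialgebra k D) (a b : D) (w : Fin 5 → D) : D :=
  (3 : ℤ) • (∑ σ : Equiv.Perm (Fin 5), (Equiv.Perm.sign σ : ℤ) •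
      A.pats (A.pats (A.pats a (w (σ 0)) (w (σ 1))) b (w (σ 2))) (w (σ 3)) (w (σ 4)))
  - (∑ σ : Equiv.Perm (Fin 5), (Equiv.Perm.sign σ : ℤ) •
      A.pats (A.pats a (A.pats (w (σ 0)) (w (σ 1)) (w (σ 2))) b) (w (σ 3)) (w (σ 4)))
  - (∑ σ : Equiv.Perm (Fin 5), (Equiv.Perm.sign σ : ℤ) •
      A.pats (A.pats a (w (σ 0)) (w (σ 1))) (A.pats (w (σ 2)) (w (σ 3)) (w (σ 4))) b)
  - (2 : ℤ) • (∑ σ : Equiv.Perm (Fin 5), (Equiv.Perm.sign σ : ℤ) •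
      A.pats a (A.pats (A.pats (w (σ 0)) (w (σ 1)) (w (σ 2))) b (w (σ 3))) (w (σ 4)))

open Equiv Equiv.Perm

section AlternatingSum

variable {M S : Type*} [AddCommGroup S]

/-- The alternating sum of `F` over all permutations of its arguments `w`,
as an additive map in `F`. -/
def altSum {n : ℕ} (w : Fin n → M) : ((Fin n → M) → S) →+ S where
  toFun F := ∑ σ : Perm (Fin n), (sign σ : ℤ) • F (w ∘ σ)
  map_zero' := by simp
  map_add' F G := by simp [Finset.sum_add_distrib]

theorem altSum_apply {n : ℕ} (w : Fin n → M) (F : (Fin n → M) → S) :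
    altSum w F = ∑ σ : Perm (Fin n), (sign σ : ℤ) • F (w ∘ σ) := rfl

theorem altSum_comp_perm {n : ℕ} (w : Fin n → M) (F : (Fin n → M) → S) (τ : Perm (Fin n)) :
    altSum w (fun y => F (y ∘ τ)) = (sign τ : ℤ) • altSum w F := by
  simp only [altSum_apply]
  rw [← Equiv.sum_comp (Equiv.mulRight τ) (fun σ => (sign σ : ℤ) • F (w ∘ σ)), Finset.smul_sum]
  refine Finset.sum_congr rfl fun σ _ => ?_
  have h : ((sign τ : ℤˣ) : ℤ) * (sign τ : ℤ) = 1 := by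
    rw [← Units.val_mul, Int.units_mul_self, Units.val_one]
  simp only [Equiv.coe_mulRight]
  rw [smul_smul, Perm.sign_mul, Units.val_mul, mul_left_comm, h, mul_one]
  rfl

theorem altSum_eq_zsmul {n : ℕ} (w : Fin n → M) {F G : (Fin n → M) → S} (τ : Perm (Fin n))
    {s : ℤ} (hs : (sign τ : ℤ) = s) (h : ∀ y, F y = G (y ∘ τ)) :
    altSum w F = s • altSum w G := by
  rw [← hs, ← altSum_comp_perm, funext h]

theorem altSum_eq_two_zsmul {n : ℕ} (w : Fin n → M) {F G : (Fin n → M) → S} {i j : Fin n}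
    (hij : i ≠ j) (h : ∀ y, F y = G y - G (y ∘ swap i j)) :
    altSum w F = (2 : ℤ) • altSum w G := by
  have hF : F = G - fun y => G (y ∘ swap i j) := funext h
  rw [hF, map_sub, altSum_comp_perm, sign_swap hij]
  simp [two_zsmul]

theorem altSum_eq_zero {n : ℕ} (w : Fin n → M) (F : (Fin n → M) → S) {i j : Fin n}
    (hij : i ≠ j) (h : w i = w j) : altSum w F = 0 := by
  have hw : w ∘ swap i j = w := by
    ext m
    rcases eq_or_ne m i with rfl | hi
    · simp [h]
    rcases eq_or_ne m j with rfl | hj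
    · simp [h]
    · simp [swap_apply_of_ne_of_ne hi hj]
  refine Finset.sum_involution (fun σ _ => swap i j * σ) (fun σ _ => ?_) (fun σ _ _ => ?_)
    (fun _ _ => Finset.mem_univ _) (fun σ _ => ?_)
  · have : w ∘ ⇑(swap i j * σ) = w ∘ σ := by
      rw [coe_mul, ← Function.comp_assoc, hw]
    rw [this, Perm.sign_mul, sign_swap hij]
    simp
  · simpa using hij
  · simp

/-- Expansion of an alternating sum along the position of the first argument. -/
theorem altSum_cons {n : ℕ} (b : M) (w : Fin n → M) (F : (Fin (n + 1) → M) → S) :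
    altSum (Fin.cons b w : Fin (n + 1) → M) F =
      altSum w (fun y => ∑ p : Fin (n + 1),
        (sign (swap 0 p) : ℤ) • F ((Fin.cons b y : Fin (n + 1) → M) ∘ swap 0 p)) := by
  simp only [altSum_apply, Finset.smul_sum]
  rw [← Equiv.sum_comp (Equiv.inv _), ← Equiv.sum_comp decomposeFin.symm, Fintype.sum_prod_type,
    Finset.sum_comm, ← Equiv.sum_comp (Equiv.inv (Perm (Fin n)))]
  refine Finset.sum_congr rfl fun σ _ => Finset.sum_congr rfl fun p _ => ?_
  have hsign : sign (decomposeFin.symm (p, σ⁻¹)) = sign σ * sign (swap 0 p) := by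
    by_cases hp : p = 0
    · simp [hp, decomposeFin.symm_sign]
    · simp [hp, decomposeFin.symm_sign, sign_swap (Ne.symm hp)]
  have hcomp : (Fin.cons b w : Fin (n + 1) → M) ∘ ⇑(decomposeFin.symm (p, σ⁻¹))⁻¹ =
      (Fin.cons b (w ∘ σ) : Fin (n + 1) → M) ∘ swap 0 p := by
    have h : (Fin.cons b w : Fin (n + 1) → M) =
        ((Fin.cons b (w ∘ σ) : Fin (n + 1) → M) ∘ swap 0 p) ∘ decomposeFin.symm (p, σ⁻¹) := by
      ext m
      refine Fin.cases ?_ (fun m => ?_) m <;> simp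
    rw [h, Function.comp_assoc, ← coe_mul, mul_inv_cancel, coe_one, Function.comp_id]
  simp only [Equiv.inv_apply, sign_inv, hsign, hcomp, Units.val_mul, smul_smul]

end AlternatingSum

section TernarySum

variable {S : Type*} [Ring S]

/-- The alternating ternary sum in an associative ring. -/
def ats (x y z : S) : S :=
  x * y * z - x * z * y - y * x * z + z * x * y + y * z * x - z * y * x

/-- The part of `ats x y z` in which `y` precedes `z`. -/
def atsHalf (x y z : S) : S := x * y * z - y * x * z + y * z * x

theorem ats_eq_sub (x y z : S) : ats x y z = atsHalf x y z - atsHalf x z y := by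
  simp only [ats, atsHalf]; abel

/-- The terms of `ats u b y` in which `u` precedes `y`. -/
def lastPart (b u y : S) : S := u * b * y - b * u * y - u * y * b

/-- The terms of `ats u b y` in which `y` precedes `u`. -/
def firstPart (b y u : S) : S := b * y * u + y * u * b - y * b * u

theorem ats_eq_add (b u y : S) : ats u b y = lastPart b u y + firstPart b y u := by
  simp only [ats, lastPart, firstPart]; abel

variable (x b : S) (w : Fin 5 → S)

/-- The alternating sum of `[[[x,y₀,y₁],b,y₂],y₃,y₄]` in terms of products in which
the `yᵢ` occur in order. -/
theorem altSum_ats_nested_left :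
    altSum w (fun y => ats (ats (ats x (y 0) (y 1)) b (y 2)) (y 3) (y 4)) =
      (4 : ℤ) • altSum w (fun y =>
        let V p q r := lastPart b (atsHalf x p q) r + firstPart b p (atsHalf x q r)
        V (y 0) (y 1) (y 2) * y 3 * y 4 + y 0 * V (y 1) (y 2) (y 3) * y 4
          + y 0 * y 1 * V (y 2) (y 3) (y 4)) := by
  rw [altSum_eq_two_zsmul w (i := 3) (j := 4)
      (G := fun y => atsHalf (ats (ats x (y 0) (y 1)) b (y 2)) (y 3) (y 4)) (by decide)
      (fun y => ats_eq_sub _ _ _),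
    altSum_eq_two_zsmul w (i := 0) (j := 1)
      (G := fun y => atsHalf (ats (atsHalf x (y 0) (y 1)) b (y 2)) (y 3) (y 4)) (by decide) ?_,
    smul_smul]
  · have hF : (fun y : Fin 5 → S => atsHalf (ats (atsHalf x (y 0) (y 1)) b (y 2)) (y 3) (y 4)) =
        (fun y => lastPart b (atsHalf x (y 0) (y 1)) (y 2) * y 3 * y 4)
        + (fun y => firstPart b (y 2) (atsHalf x (y 0) (y 1)) * y 3 * y 4)
        - (fun y => y 3 * lastPart b (atsHalf x (y 0) (y 1)) (y 2) * y 4)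
        - (fun y => y 3 * firstPart b (y 2) (atsHalf x (y 0) (y 1)) * y 4)
        + (fun y => y 3 * y 4 * lastPart b (atsHalf x (y 0) (y 1)) (y 2))
        + (fun y => y 3 * y 4 * firstPart b (y 2) (atsHalf x (y 0) (y 1))) := by
      ext y
      simp only [Pi.add_apply, Pi.sub_apply, ats_eq_add, atsHalf]
      noncomm_ring
    rw [hF]
    simp only [map_add, map_sub]
    rw [
      altSum_eq_zsmul w (F := fun y => firstPart b (y 2) (atsHalf x (y 0) (y 1)) * y 3 * y 4)
        (G := fun y => firstPart b (y 0) (atsHalf x (y 1) (y 2)) * y 3 * y 4)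
        c[0, 2, 1] (s := 1) (by decide) (fun y => rfl),
      altSum_eq_zsmul w (F := fun y => y 3 * lastPart b (atsHalf x (y 0) (y 1)) (y 2) * y 4)
        (G := fun y => y 0 * lastPart b (atsHalf x (y 1) (y 2)) (y 3) * y 4)
        c[0, 3, 2, 1] (s := -1) (by decide) (fun y => rfl),
      altSum_eq_zsmul w (F := fun y => y 3 * firstPart b (y 2) (atsHalf x (y 0) (y 1)) * y 4)
        (G := fun y => y 0 * firstPart b (y 1) (atsHalf x (y 2) (y 3)) * y 4)
        c[0, 3, 1, 2] (s := -1) (by decide) (fun y => rfl),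
      altSum_eq_zsmul w (F := fun y => y 3 * y 4 * lastPart b (atsHalf x (y 0) (y 1)) (y 2))
        (G := fun y => y 0 * y 1 * lastPart b (atsHalf x (y 2) (y 3)) (y 4))
        c[0, 3, 1, 4, 2] (s := 1) (by decide) (fun y => rfl),
      altSum_eq_zsmul w (F := fun y => y 3 * y 4 * firstPart b (y 2) (atsHalf x (y 0) (y 1)))
        (G := fun y => y 0 * y 1 * firstPart b (y 2) (atsHalf x (y 3) (y 4)))
        (c[0, 3] * c[1, 4]) (s := 1) (by decide) (fun y => rfl)]
    simp only [← map_zsmul, ← map_add, ← map_sub]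
    congr 2
    ext y
    simp only [Pi.add_apply, Pi.sub_apply, Pi.smul_apply, lastPart, firstPart, atsHalf]
    noncomm_ring
  · intro y
    have h0 : swap (0 : Fin 5) 1 2 = 2 := by decide
    have h1 : swap (0 : Fin 5) 1 3 = 3 := by decide
    have h2 : swap (0 : Fin 5) 1 4 = 4 := by decide
    simp only [Function.comp_apply, swap_apply_left, swap_apply_right, h0, h1, h2, ats_eq_sub x]
    simp only [ats, atsHalf]
    noncomm_ring

theorem altSum_ats_inner {i j l : Fin 5} (hij : i ≠ j) (hjl : j ≠ l) (hil : i ≠ l)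
    (G : (Fin 5 → S) → S → S) (hadd : ∀ y t u, G y (t + u) = G y t + G y u)
    (hGij : ∀ y, G (y ∘ swap i j) = G y) (hGjl : ∀ y, G (y ∘ swap j l) = G y) :
    altSum w (fun y => G y (ats (y i) (y j) (y l))) =
      (6 : ℤ) • altSum w (fun y => G y (y i * y j * y l)) := by
  have hsub y t u : G y (t - u) = G y t - G y u := by
    rw [eq_sub_iff_add_eq, ← hadd, sub_add_cancel]
  have h : (fun y : Fin 5 → S => G y (atsHalf (y i) (y j) (y l))) =
      (fun y => G y (y i * y j * y l)) - (fun y => G y (y j * y i * y l))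
        + (fun y => G y (y j * y l * y i)) := by
    ext y
    simp [atsHalf, hadd, hsub]
  have hcomp y : G (y ∘ ⇑(swap i j * swap j l)) = G y := by
    rw [coe_mul, ← Function.comp_assoc, hGjl, hGij]
  rw [altSum_eq_two_zsmul w (i := j) (j := l)
      (G := fun y => G y (atsHalf (y i) (y j) (y l))) hjl ?_, h, map_add, map_sub,
    altSum_eq_zsmul w (F := fun y => G y (y j * y i * y l))
      (G := fun y => G y (y i * y j * y l)) (swap i j) (s := -1) ?_ ?_,
    altSum_eq_zsmul w (F := fun y => G y (y j * y l * y i))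
      (G := fun y => G y (y i * y j * y l)) (swap i j * swap j l) (s := 1) ?_ ?_]
  · module
  · simp [Perm.sign_mul, hij, hjl]
  · intro y
    rw [hcomp]
    simp [swap_apply_of_ne_of_ne, hij, hil, hjl.symm, hil.symm]
  · simp [hij]
  · intro y
    rw [hGij]
    simp [swap_apply_of_ne_of_ne, hjl.symm, hil.symm]
  · intro y
    rw [hGjl, ← hsub]
    simp [ats_eq_sub, swap_apply_of_ne_of_ne, hij, hil]

/-- The alternating sum of `[[x,[y₀,y₁,y₂],b],y₃,y₄]` in terms of products in which
the `yᵢ` occur in order. -/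
theorem altSum_ats_middle_left :
    altSum w (fun y => ats (ats x (ats (y 0) (y 1) (y 2)) b) (y 3) (y 4)) =
      (12 : ℤ) • altSum w (fun y =>
        ats x (y 0 * y 1 * y 2) b * y 3 * y 4 + y 0 * ats x (y 1 * y 2 * y 3) b * y 4
        + y 0 * y 1 * ats x (y 2 * y 3 * y 4) b) := by
  rw [altSum_eq_two_zsmul w (i := 3) (j := 4)
      (G := fun y => atsHalf (ats x (ats (y 0) (y 1) (y 2)) b) (y 3) (y 4)) (by decide)
      (fun y => ats_eq_sub _ _ _),
    altSum_ats_inner w (i := 0) (j := 1) (l := 2) (by decide) (by decide) (by decide)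
      (fun y t => atsHalf (ats x t b) (y 3) (y 4))
      (fun _ _ _ => by simp only [ats, atsHalf]; noncomm_ring) (fun _ => rfl) (fun _ => rfl)]
  have hF : (fun y : Fin 5 → S => atsHalf (ats x (y 0 * y 1 * y 2) b) (y 3) (y 4)) =
      (fun y => ats x (y 0 * y 1 * y 2) b * y 3 * y 4)
      - (fun y => y 3 * ats x (y 0 * y 1 * y 2) b * y 4)
      + (fun y => y 3 * y 4 * ats x (y 0 * y 1 * y 2) b) := by
    ext y
    simp only [Pi.add_apply, Pi.sub_apply, atsHalf]
  rw [hF]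
  simp only [map_add, map_sub]
  rw [
    altSum_eq_zsmul w (F := fun y => y 3 * ats x (y 0 * y 1 * y 2) b * y 4)
      (G := fun y => y 0 * ats x (y 1 * y 2 * y 3) b * y 4)
      c[0, 3, 2, 1] (s := -1) (by decide) (fun y => rfl),
    altSum_eq_zsmul w (F := fun y => y 3 * y 4 * ats x (y 0 * y 1 * y 2) b)
      (G := fun y => y 0 * y 1 * ats x (y 2 * y 3 * y 4) b)
      c[0, 3, 1, 4, 2] (s := 1) (by decide) (fun y => rfl),
    smul_smul]
  simp only [← map_zsmul, ← map_add, ← map_sub]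
  congr 2
  ext y
  simp only [Pi.add_apply, Pi.sub_apply, Pi.smul_apply, ats]
  noncomm_ring

/-- The alternating sum of `[[x,y₀,y₁],[y₂,y₃,y₄],b]` in terms of products in which
the `yᵢ` occur in order. -/
theorem altSum_ats_left_middle :
    altSum w (fun y => ats (ats x (y 0) (y 1)) (ats (y 2) (y 3) (y 4)) b) =
      (12 : ℤ) • altSum w (fun y =>
        -lastPart b (atsHalf x (y 0) (y 1)) (y 2 * y 3 * y 4)
          - firstPart b (y 0 * y 1 * y 2) (atsHalf x (y 3) (y 4))) := by
  rw [altSum_eq_two_zsmul w (i := 0) (j := 1)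
      (G := fun y => ats (atsHalf x (y 0) (y 1)) (ats (y 2) (y 3) (y 4)) b) (by decide)
      (fun y => by
        rw [ats_eq_sub x]
        change _ = ats _ (ats (y 2) (y 3) (y 4)) _
          - ats (atsHalf x (y 1) (y 0)) (ats (y 2) (y 3) (y 4)) _
        generalize ats (y 2) (y 3) (y 4) = t
        simp only [ats]
        noncomm_ring),
    altSum_ats_inner w (i := 2) (j := 3) (l := 4) (by decide) (by decide) (by decide)
      (fun y t => ats (atsHalf x (y 0) (y 1)) t b)
      (fun _ _ _ => by simp only [ats]; noncomm_ring) (fun _ => rfl) (fun _ => rfl)]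
  have hF : (fun y : Fin 5 → S => ats (atsHalf x (y 0) (y 1)) (y 2 * y 3 * y 4) b) =
      (fun y => -lastPart b (atsHalf x (y 0) (y 1)) (y 2 * y 3 * y 4))
      - (fun y => firstPart b (y 2 * y 3 * y 4) (atsHalf x (y 0) (y 1))) := by
    ext y
    simp only [Pi.sub_apply, ats, lastPart, firstPart]
    noncomm_ring
  rw [hF]
  simp only [map_sub]
  rw [
    altSum_eq_zsmul w (F := fun y => firstPart b (y 2 * y 3 * y 4) (atsHalf x (y 0) (y 1)))
      (G := fun y => firstPart b (y 0 * y 1 * y 2) (atsHalf x (y 3) (y 4)))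
      c[0, 2, 4, 1, 3] (s := 1) (by decide) (fun y => rfl),
    smul_smul]
  simp only [← map_zsmul, ← map_sub]
  congr 2
  ext y
  simp only [Pi.sub_apply, Pi.smul_apply, lastPart, firstPart]
  noncomm_ring

/-- The alternating sum of `[x,[[y₀,y₁,y₂],b,y₃],y₄]` in terms of products in which
the `yᵢ` occur in order. -/
theorem altSum_ats_left_nested_middle :
    altSum w (fun y => ats x (ats (ats (y 0) (y 1) (y 2)) b (y 3)) (y 4)) =
      (6 : ℤ) • altSum w (fun y =>
        let W p q r s := lastPart b (p * q * r) s - firstPart b p (q * r * s)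
        atsHalf x (W (y 0) (y 1) (y 2) (y 3)) (y 4) - atsHalf x (y 0) (W (y 1) (y 2) (y 3) (y 4))) := by
  rw [
    altSum_ats_inner w (i := 0) (j := 1) (l := 2) (by decide) (by decide) (by decide)
      (fun y t => ats x (ats t b (y 3)) (y 4))
      (fun _ _ _ => by simp only [ats]; noncomm_ring) (fun _ => rfl) (fun _ => rfl)]
  have hF : (fun y : Fin 5 → S => ats x (ats (y 0 * y 1 * y 2) b (y 3)) (y 4)) =
      (fun y => atsHalf x (lastPart b (y 0 * y 1 * y 2) (y 3)) (y 4))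
      + (fun y => atsHalf x (firstPart b (y 3) (y 0 * y 1 * y 2)) (y 4))
      - (fun y => atsHalf x (y 4) (lastPart b (y 0 * y 1 * y 2) (y 3)))
      - (fun y => atsHalf x (y 4) (firstPart b (y 3) (y 0 * y 1 * y 2))) := by
    ext y
    simp only [Pi.add_apply, Pi.sub_apply, lastPart, firstPart, atsHalf, ats]
    noncomm_ring
  rw [hF]
  simp only [map_add, map_sub]
  rw [
    altSum_eq_zsmul w (F := fun y => atsHalf x (firstPart b (y 3) (y 0 * y 1 * y 2)) (y 4))
      (G := fun y => atsHalf x (firstPart b (y 0) (y 1 * y 2 * y 3)) (y 4))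
      c[0, 3, 2, 1] (s := -1) (by decide) (fun y => rfl),
    altSum_eq_zsmul w (F := fun y => atsHalf x (y 4) (lastPart b (y 0 * y 1 * y 2) (y 3)))
      (G := fun y => atsHalf x (y 0) (lastPart b (y 1 * y 2 * y 3) (y 4)))
      c[0, 4, 3, 2, 1] (s := 1) (by decide) (fun y => rfl),
    altSum_eq_zsmul w (F := fun y => atsHalf x (y 4) (firstPart b (y 3) (y 0 * y 1 * y 2)))
      (G := fun y => atsHalf x (y 0) (firstPart b (y 1) (y 2 * y 3 * y 4)))
      (c[0, 4, 2] * c[1, 3]) (s := -1) (by decide) (fun y => rfl)]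
  simp only [← map_zsmul, ← map_add, ← map_sub]
  congr 2
  ext y
  simp only [Pi.add_apply, Pi.sub_apply, Pi.smul_apply, lastPart, firstPart, atsHalf]
  noncomm_ring

/-- The signed sum of the products obtained by inserting `x` at every position of `z`. -/
def insertSum (z : Fin 6 → S) : S :=
  x * z 0 * z 1 * z 2 * z 3 * z 4 * z 5 - z 0 * x * z 1 * z 2 * z 3 * z 4 * z 5
    + z 0 * z 1 * x * z 2 * z 3 * z 4 * z 5 - z 0 * z 1 * z 2 * x * z 3 * z 4 * z 5
    + z 0 * z 1 * z 2 * z 3 * x * z 4 * z 5 - z 0 * z 1 * z 2 * z 3 * z 4 * x * z 5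
    + z 0 * z 1 * z 2 * z 3 * z 4 * z 5 * x

theorem altSum_insertSum_eq_zero (w : Fin 5 → S) :
    altSum w (fun y =>
      insertSum x ![w 1, y 0, y 1, y 2, y 3, y 4] - insertSum x ![y 0, w 1, y 1, y 2, y 3, y 4]
      + insertSum x ![y 0, y 1, w 1, y 2, y 3, y 4] - insertSum x ![y 0, y 1, y 2, w 1, y 3, y 4]
      + insertSum x ![y 0, y 1, y 2, y 3, w 1, y 4]
      - insertSum x ![y 0, y 1, y 2, y 3, y 4, w 1]) = 0 := by
  have h : altSum (Fin.cons (w 1) w : Fin 6 → S) (insertSum x) = 0 :=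
    altSum_eq_zero _ _ (i := 0) (j := 2) (by decide) rfl
  rw [altSum_cons] at h
  generalize w 1 = b at h ⊢
  rw [← h]
  have hF : (fun y : Fin 5 → S => ∑ p : Fin 6,
        (sign (swap 0 p) : ℤ) • insertSum x ((Fin.cons b y : Fin 6 → S) ∘ swap 0 p)) =
      (fun y => insertSum x ![b, y 0, y 1, y 2, y 3, y 4])
      - (fun y => insertSum x ![y 0, b, y 1, y 2, y 3, y 4])
      - (fun y => insertSum x ![y 1, y 0, b, y 2, y 3, y 4])
      - (fun y => insertSum x ![y 2, y 0, y 1, b, y 3, y 4])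
      - (fun y => insertSum x ![y 3, y 0, y 1, y 2, b, y 4])
      - (fun y => insertSum x ![y 4, y 0, y 1, y 2, y 3, b]) := by
    ext y
    have hs : ∀ p : Fin 6, (sign (swap 0 p) : ℤ) = if p = 0 then 1 else -1 := by decide
    simp only [hs, Fin.sum_univ_succ, Pi.sub_apply]
    simp only [sub_eq_add_neg, Fin.sum_univ_zero, Fin.succ_ne_zero, if_true, if_false,
      one_smul, neg_smul, add_zero, add_assoc]
    rfl
  rw [hF]
  simp only [map_sub]
  rw [
    altSum_eq_zsmul w (F := fun y => insertSum x ![y 1, y 0, b, y 2, y 3, y 4])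
      (G := fun y => insertSum x ![y 0, y 1, b, y 2, y 3, y 4])
      c[0, 1] (s := -1) (by decide) (fun y => rfl),
    altSum_eq_zsmul w (F := fun y => insertSum x ![y 2, y 0, y 1, b, y 3, y 4])
      (G := fun y => insertSum x ![y 0, y 1, y 2, b, y 3, y 4])
      c[0, 2, 1] (s := 1) (by decide) (fun y => rfl),
    altSum_eq_zsmul w (F := fun y => insertSum x ![y 3, y 0, y 1, y 2, b, y 4])
      (G := fun y => insertSum x ![y 0, y 1, y 2, y 3, b, y 4])
      c[0, 3, 2, 1] (s := -1) (by decide) (fun y => rfl),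
    altSum_eq_zsmul w (F := fun y => insertSum x ![y 4, y 0, y 1, y 2, y 3, b])
      (G := fun y => insertSum x ![y 0, y 1, y 2, y 3, y 4, b])
      c[0, 4, 3, 2, 1] (s := 1) (by decide) (fun y => rfl)]
  simp only [← map_zsmul, ← map_sub]
  congr 1
  ext y
  simp only [Pi.sub_apply, Pi.smul_apply]
  module

/-- The identity for the alternating ternary sum in an associative ring, with a distinguished
first argument `x`. -/
theorem ats_identity (w : Fin 5 → S) :
    (3 : ℤ) • altSum w (fun y => ats (ats (ats x (y 0) (y 1)) (w 1) (y 2)) (y 3) (y 4))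
      - altSum w (fun y => ats (ats x (ats (y 0) (y 1) (y 2)) (w 1)) (y 3) (y 4))
      - altSum w (fun y => ats (ats x (y 0) (y 1)) (ats (y 2) (y 3) (y 4)) (w 1))
      - (2 : ℤ) • altSum w (fun y => ats x (ats (ats (y 0) (y 1) (y 2)) (w 1) (y 3)) (y 4))
      = 0 := by
  have h := congrArg ((36 : ℤ) • ·) (altSum_insertSum_eq_zero x w)
  simp only [smul_zero] at h
  rw [altSum_ats_nested_left, altSum_ats_middle_left, altSum_ats_left_middle, altSum_ats_left_nested_middle]
  refine Eq.trans ?_ h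
  simp only [← map_zsmul, ← map_sub]
  congr 1
  ext y
  simp only [Pi.sub_apply, Pi.smul_apply, insertSum, ats, atsHalf, lastPart, firstPart,
    Matrix.cons_val]
  noncomm_ring

end TernarySum

namespace Dialgebra

variable {k D : Type*} [CommRing k] [AddCommGroup D] [Module k D] (A : Dialgebra k D)

/-- The endomorphisms of `D` commuting with all left multiplications `y ⊢ ·`. -/
abbrev leftCentralizer : Subalgebra k (Module.End k D) :=
  Subalgebra.centralizer k (Set.range A.r)

/-- Right multiplication `· ⊣ y`. -/
def rightMul : D →ₗ[k] A.leftCentralizer :=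
  A.l.flip.codRestrict (Subalgebra.toSubmodule A.leftCentralizer) (by
    rintro y _ ⟨z, rfl⟩
    ext d
    simp [A.inner_assoc])

theorem coe_rightMul_apply (y d : D) : (A.rightMul y : Module.End k D) d = A.l d y := rfl

/-- The space on which both `D` as a bimodule and `D` as a ring are represented. -/
abbrev RepSpace : Type _ := A.leftCentralizer × D

/-- The representation of `D` in which the two products of `D` coincide. -/
def rep : D →ₗ[k] Module.End k A.RepSpace where
  toFun y := LinearMap.prodMap (LinearMap.mulRight k (A.rightMul y)) (A.r y)
  map_add' y z := by ext <;> simp [mul_add]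
  map_smul' c y := by ext <;> simp

/-- The faithful representation of `D` as a bimodule over the image of `rep`. -/
def bimoduleRep : D →ₗ[k] Module.End k A.RepSpace where
  toFun x := LinearMap.inr k A.leftCentralizer D ∘ₗ
    (LinearMap.applyₗ x ∘ₗ A.leftCentralizer.val.toLinearMap) ∘ₗ LinearMap.fst k _ _
  map_add' x y := by ext <;> simp
  map_smul' c x := by ext <;> simp

theorem bimoduleRep_injective : Function.Injective A.bimoduleRep := by
  intro x y h
  simpa [bimoduleRep] using congrArg (fun f => (f (1, 0)).2) h

theorem rep_l (y z : D) : A.rep (A.l y z) = A.rep y * A.rep z := by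
  refine LinearMap.ext fun ⟨p, d⟩ => Prod.ext (Subtype.ext (LinearMap.ext fun v => ?_)) ?_
  · simp [rep, coe_rightMul_apply, A.l_assoc]
  · simp [rep, A.bar_right, A.r_assoc]

theorem rep_r (y z : D) : A.rep (A.r y z) = A.rep y * A.rep z := by
  refine LinearMap.ext fun ⟨p, d⟩ => Prod.ext (Subtype.ext (LinearMap.ext fun v => ?_)) ?_
  · simp [rep, coe_rightMul_apply, A.l_assoc, A.bar_left]
  · simp [rep, A.r_assoc]

theorem bimoduleRep_l (x y : D) : A.bimoduleRep (A.l x y) = A.bimoduleRep x * A.rep y := by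
  refine LinearMap.ext fun ⟨p, d⟩ => Prod.ext rfl ?_
  simp [rep, bimoduleRep, coe_rightMul_apply]

theorem bimoduleRep_r (x y : D) : A.bimoduleRep (A.r y x) = A.rep y * A.bimoduleRep x := by
  refine LinearMap.ext fun ⟨p, d⟩ => Prod.ext ?_ ?_
  · simp [rep, bimoduleRep]
  · simpa [rep, bimoduleRep] using
      (LinearMap.congr_fun ((Subalgebra.mem_centralizer_iff k).1 p.2 _ ⟨y, rfl⟩) x).symm

theorem rep_pats (x y z : D) : A.rep (A.pats x y z) = ats (A.rep x) (A.rep y) (A.rep z) := by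
  simp only [pats, ats, map_add, map_sub, rep_l, rep_r, mul_assoc]

theorem bimoduleRep_pats (x y z : D) :
    A.bimoduleRep (A.pats x y z) = ats (A.bimoduleRep x) (A.rep y) (A.rep z) := by
  simp only [pats, ats, map_add, map_sub, bimoduleRep_l, bimoduleRep_r, mul_assoc]

theorem I22111_eq_zero (a : D) (w : Fin 5 → D) : I22111 A a (w 1) w = 0 := by
  have h := ats_identity (A.bimoduleRep a) (A.rep ∘ w)
  simp only [altSum_apply, Function.comp_apply, ← rep_pats, ← bimoduleRep_pats] at h
  apply A.bimoduleRep_injective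
  rw [map_zero, ← h]
  simp only [I22111, map_sub, map_sum, map_zsmul]

end Dialgebra

/-- the PATS satisfies the nonlinear degree-7 identity `12·I₂₂₁₁₁ = 0`
in the variables `a,a,b,b,c,d,e` (σ permuting the five letters `(a,b,c,d,e)`), and
also the identity obtained by interchanging `a` and `b`. -/
theorem pats_identity_I22111
    (k D : Type*) [CommRing k] [AddCommGroup D] [Module k D]
    (A : Dialgebra k D) (a b c d e : D) :
    I22111 A a b ![a,b,c,d,e] = 0 ∧ I22111 A b a ![b,a,c,d,e] = 0 := by
  exact ⟨A.I22111_eq_zero a ![a, b, c, d, e], A.I22111_eq_zero b ![b, a, c, d, e]⟩
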